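/- The spectrum of the adjacency operator of the 3-regular tree equals the real interval [−2√2, 2√2]: if Ad is a bounded operator on ℓ²(V; ℂ) satisfying (Ad f)(v) = Σ_{w adjacent to v} f(w) for all f ∈ ℓ²(V; ℂ) and all vertices v, then the spectrum of Ad equals {z ∈ ℂ : z is real and |z| ≤ 2√2}. -/

import Mathlib

noncomputable section

open scoped BigOperators

/-- Combinatorial structure of the rooted 3-regular tree. -/
theorem tree_struct {V : Type*} (G : SimpleGraph V)
    (hconn : G.Connected) (hacyclic : G.IsAcyclic)
    (hdeg : ∀ v : V, Nat.card (G.neighborSet v) = 3) :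
    ∃ (d : V → ℕ) (nb : V → Finset V) (o : V), (∀ v w, w ∈ nb v ↔ G.Adj v w) ∧
      (∀ v, d v = 0 ↔ v = o) ∧ (∀ v, (nb v).card = 3) ∧
      (∀ v, ∀ w ∈ nb v, d v = d w + 1 ∨ d w = d v + 1) ∧
      (∀ v, d v ≠ 0 → ((nb v).filter (fun w => d w + 1 = d v)).card = 1) := by
  classical
  obtain ⟨o⟩ := hconn.nonempty
  have hfin : ∀ v, (G.neighborSet v).Finite := fun v => by
    have := Nat.finite_of_card_ne_zero (α := G.neighborSet v) (by rw [hdeg]; norm_num)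
    exact Set.toFinite _
  refine ⟨fun v => G.dist o v, fun v => (hfin v).toFinset, o, ?_, ?_, ?_, ?_, ?_⟩
  · intro v w; simp
  · intro v
    rw [hconn.dist_eq_zero_iff]
    exact eq_comm
  · intro v
    have h := hdeg v
    rw [Nat.card_coe_set_eq, Set.ncard_eq_toFinset_card _ (hfin v)] at h
    exact h
  · intro v w hw
    exact hacyclic.dist_eq_dist_add_one_of_adj_of_reachable o (by simpa using hw) (hconn o v)
  · intro v hv
    rw [Finset.card_eq_one]
    obtain ⟨p, hp⟩ := hconn.exists_walk_length_eq_dist v o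
    rw [SimpleGraph.dist_comm] at hp
    cases p with
    | nil => exact absurd hp.symm hv
    | @cons _ a _ h q =>
      refine ⟨a, ?_⟩
      have ha : G.dist o a + 1 = G.dist o v := by
        have h1 := SimpleGraph.dist_le q
        rw [SimpleGraph.dist_comm] at h1
        rw [SimpleGraph.Walk.length_cons] at hp
        rcases hacyclic.dist_eq_dist_add_one_of_adj_of_reachable o h (hconn o v) with h2 | h2 <;>
          omega
      ext b
      simp only [Finset.mem_filter, Set.Finite.mem_toFinset, SimpleGraph.mem_neighborSet,
        Finset.mem_singleton]
      constructor
      · rintro ⟨hb, hdb⟩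
        obtain ⟨p1, hp1⟩ := hconn.exists_walk_length_eq_dist o a
        obtain ⟨p2, hp2⟩ := hconn.exists_walk_length_eq_dist o b
        have e1 := (p1.concat h.symm).isPath_of_length_eq_dist (by
          rw [SimpleGraph.Walk.length_concat]; omega)
        have e2 := (p2.concat hb.symm).isPath_of_length_eq_dist (by
          rw [SimpleGraph.Walk.length_concat]; omega)
        have := congrArg (fun p : G.Path o v => p.1.penultimate)
          ((hacyclic.subsingleton_path o v).elim ⟨_, e1⟩ ⟨_, e2⟩)
        simpa using this.symm
      · rintro rfl
        exact ⟨h, ha⟩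

/-- Abstract Weyl-sequence argument. -/
theorem weyl_aux {H : Type*} [NormedAddCommGroup H] [InnerProductSpace ℂ H] [CompleteSpace H]
    (A : H →L[ℂ] H) (u : ℕ → H) (C : ℝ) (hC : 0 < C) (hn : ∀ k, ‖u k‖ ^ 2 = C)
    (ho : ∀ i j, i ≠ j → inner ℂ (u i) (u j) = 0)
    (hA : ∀ k, A (u (k + 1)) = ((√2 : ℝ) : ℂ) • (u (k + 2) + u k))
    (x : ℝ) (hx : |x| ≤ 2 * √2) : (x : ℂ) ∈ spectrum ℂ A := by
  obtain ⟨z, hz1, hz2⟩ : ∃ z : ℂ, ‖z‖ = 1 ∧ (x : ℂ) * z = ((√2 : ℝ) : ℂ) * (z ^ 2 + 1) := by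
    have hs : (0 : ℝ) < 2 * √2 := by positivity
    have hc : Real.cos (Real.arccos (x / (2 * √2))) = x / (2 * √2) := by
      rw [abs_le] at hx
      apply Real.cos_arccos
      · rw [le_div_iff₀ hs]; linarith
      · rw [div_le_iff₀ hs]; linarith
    set t := Real.arccos (x / (2 * √2))
    have hx' : x = 2 * √2 * Real.cos t := by rw [hc]; field_simp
    refine ⟨Complex.exp (t * Complex.I), Complex.norm_exp_ofReal_mul_I t, ?_⟩
    rw [hx', Complex.exp_mul_I]
    have := Complex.sin_sq_add_cos_sq (t : ℂ)
    push_cast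
    linear_combination ((√2 : ℝ) : ℂ) * this + ((√2 : ℝ) : ℂ) * (Complex.sin t)^2 * (-Complex.I_sq)
  intro hres
  obtain ⟨B, hB⟩ := hres
  set T : H →L[ℂ] H := algebraMap ℂ (H →L[ℂ] H) x - A with hT
  have hTapp : ∀ f, T f = (x : ℂ) • f - A f := fun f => by
    simp [hT, Algebra.algebraMap_eq_smul_one]
  have hinv : ∀ f, ‖f‖ ≤ ‖(↑B⁻¹ : H →L[ℂ] H)‖ * ‖T f‖ := fun f => by
    have h : (↑B⁻¹ : H →L[ℂ] H) (T f) = f := by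
      have : (↑B⁻¹ : H →L[ℂ] H) * T = 1 := by rw [← hB]; exact B.inv_mul
      exact congrArg (fun S : H →L[ℂ] H => S f) this
    calc ‖f‖ = ‖(↑B⁻¹ : H →L[ℂ] H) (T f)‖ := by rw [h]
      _ ≤ _ := ContinuousLinearMap.le_opNorm _ _
  set F : ℕ → H := fun N => ∑ k ∈ Finset.range (N + 1), z ^ k • u k with hF
  have hTF : ∀ N, T (F N) = ((√2 : ℝ) : ℂ) • (z ^ (N + 1) • u N - z ^ N • u (N + 1)) +
      (T (F 0) - ((√2 : ℝ) : ℂ) • (z • u 0 - u 1)) := by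
    intro N
    induction N with
    | zero => simp
    | succ N ih =>
      have : F (N + 1) = F N + z ^ (N + 1) • u (N + 1) := by
        simp only [hF]; rw [Finset.sum_range_succ]
      rw [this, map_add, ih, map_smul, hTapp (u (N + 1)), hA]
      have e : (z ^ (N + 1)) • ((x : ℂ) • u (N + 1))
          = (((√2 : ℝ) : ℂ) * (z ^ (N + 2) + z ^ N)) • u (N + 1) := by
        rw [smul_smul]
        congr 1
        rw [pow_succ]
        linear_combination z ^ N * hz2
      rw [smul_sub (z ^ (N + 1)), e]
      module
  have hnu : ∀ k, ‖u k‖ = √C := fun k => by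
    rw [← hn k, Real.sqrt_sq (norm_nonneg _)]
  have hbd : ∀ N, ‖T (F N)‖ ≤ √2 * (√C + √C) + ‖T (F 0) - ((√2 : ℝ) : ℂ) • (z • u 0 - u 1)‖ := by
    intro N
    rw [hTF]
    refine (norm_add_le _ _).trans ?_
    gcongr
    rw [norm_smul]
    have : ‖((√2 : ℝ) : ℂ)‖ = √2 := by
      rw [Complex.norm_real]; exact Real.norm_of_nonneg (Real.sqrt_nonneg _)
    rw [this]
    gcongr
    refine (norm_sub_le _ _).trans ?_
    simp [norm_smul, hz1, hnu]
  have hnF : ∀ N : ℕ, ‖F N‖ ^ 2 = (N + 1) * C := by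
    intro N
    induction N with
    | zero => simp [hF, hn]
    | succ N ih =>
      have : F (N + 1) = F N + z ^ (N + 1) • u (N + 1) := by
        simp only [hF]; rw [Finset.sum_range_succ]
      have h0 : inner ℂ (F N) (z ^ (N + 1) • u (N + 1)) = 0 := by
        simp only [hF, sum_inner]
        apply Finset.sum_eq_zero
        intro i hi
        rw [inner_smul_left, inner_smul_right, ho i (N + 1) (by simp at hi; omega)]
        simp
      have h1 := norm_add_sq_eq_norm_sq_add_norm_sq_of_inner_eq_zero _ _ h0
      rw [this, pow_two, h1, ← pow_two, ih, ← pow_two, norm_smul, norm_pow, hz1, one_pow, one_mul, hn]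
      push_cast; ring
  set D := √2 * (√C + √C) + ‖T (F 0) - ((√2 : ℝ) : ℂ) • (z • u 0 - u 1)‖
  set K := ‖(↑B⁻¹ : H →L[ℂ] H)‖
  obtain ⟨N, hN⟩ := exists_nat_gt ((K * D) ^ 2 / C)
  rw [div_lt_iff₀ hC] at hN
  have h1 : ‖F N‖ ≤ K * D := (hinv _).trans (by
    have := hbd N
    gcongr)
  have h2 : ‖F N‖ ^ 2 ≤ (K * D) ^ 2 := by gcongr
  rw [hnF] at h2
  linarith

/-- Exact counts of the neighbours one level up. -/
theorem up_card {V : Type*} (d : V → ℕ) (nb : V → Finset V)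
    (h3 : ∀ v, (nb v).card = 3)
    (hstep : ∀ v, ∀ w ∈ nb v, d v = d w + 1 ∨ d w = d v + 1)
    (hone : ∀ v, d v ≠ 0 → ((nb v).filter (fun w => d w + 1 = d v)).card = 1)
    (v : V) (hv : d v ≠ 0) : ((nb v).filter (fun w => d w = d v + 1)).card = 2 := by
  have h := Finset.card_filter_add_card_filter_not (s := nb v) (fun w => d w + 1 = d v)
  rw [hone v hv, h3 v] at h
  have e : (nb v).filter (fun w => ¬ (d w + 1 = d v)) = (nb v).filter (fun w => d w = d v + 1) := by
    apply Finset.filter_congr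
    intro w hw
    have := hstep v w hw
    omega
  rw [e] at h
  omega

/-- The Schur weight. -/
theorem weight_bound {V : Type*} (d : V → ℕ) (nb : V → Finset V)
    (h3 : ∀ v, (nb v).card = 3)
    (hstep : ∀ v, ∀ w ∈ nb v, d v = d w + 1 ∨ d w = d v + 1)
    (hone : ∀ v, d v ≠ 0 → ((nb v).filter (fun w => d w + 1 = d v)).card = 1) (v : V) :
    ∑ w ∈ nb v, (√2 : ℝ)⁻¹ ^ d w ≤ 2 * √2 * (√2 : ℝ)⁻¹ ^ d v := by
  have hs : (0 : ℝ) < √2 := by positivity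
  have hss : (√2 : ℝ) ^ 2 = 2 := Real.sq_sqrt (by norm_num)
  have hi : (√2 : ℝ)⁻¹ * 2 = √2 := by field_simp; linarith
  by_cases hv : d v = 0
  · have : ∀ w ∈ nb v, (√2 : ℝ)⁻¹ ^ d w = (√2 : ℝ)⁻¹ := by
      intro w hw
      have : d w = 1 := by have := hstep v w hw; omega
      rw [this, pow_one]
    rw [Finset.sum_congr rfl this, Finset.sum_const, h3, hv, pow_zero]
    simp only [nsmul_eq_mul]
    push_cast
    linarith
  · rw [← Finset.sum_filter_add_sum_filter_not (nb v) (fun w => d w + 1 = d v)]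
    have h1 : ∀ w ∈ (nb v).filter (fun w => d w + 1 = d v),
        (√2 : ℝ)⁻¹ ^ d w = √2 * (√2 : ℝ)⁻¹ ^ d v := by
      intro w hw
      rw [← (Finset.mem_filter.1 hw).2, pow_succ]
      field_simp
    have h2 : ∀ w ∈ (nb v).filter (fun w => ¬ (d w + 1 = d v)),
        (√2 : ℝ)⁻¹ ^ d w = (√2 : ℝ)⁻¹ * (√2 : ℝ)⁻¹ ^ d v := by
      intro w hw
      have hw := Finset.mem_filter.1 hw
      have : d w = d v + 1 := by have := hstep v w hw.1; omega
      rw [this, pow_succ']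
    have e : ((nb v).filter (fun w => ¬ (d w + 1 = d v))).card = 2 := by
      have h := Finset.card_filter_add_card_filter_not (s := nb v) (fun w => d w + 1 = d v)
      rw [hone v hv, h3 v] at h
      omega
    rw [Finset.sum_congr rfl h1, Finset.sum_congr rfl h2, Finset.sum_const, Finset.sum_const,
      hone v hv, e]
    simp only [nsmul_eq_mul]
    push_cast
    apply le_of_eq
    linear_combination (√2 : ℝ)⁻¹ ^ d v * hi

/-- Schur test. -/
theorem schur_bound {V : Type*} (nb : V → Finset V) (φ : V → ℝ) (c : ℝ) (hc : 0 ≤ c)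
    (hsymm : ∀ v w, w ∈ nb v ↔ v ∈ nb w)
    (hφ : ∀ v, 0 < φ v) (hb : ∀ v, ∑ w ∈ nb v, φ w ≤ c * φ v)
    (Ad : lp (fun _ : V => ℂ) 2 →L[ℂ] lp (fun _ : V => ℂ) 2)
    (hAd : ∀ (f : lp (fun _ : V => ℂ) 2) (v : V),
      (Ad f : ∀ _ : V, ℂ) v = ∑ w ∈ nb v, (f : ∀ _ : V, ℂ) w) : ‖Ad‖ ≤ c := by
  classical
  refine ContinuousLinearMap.opNorm_le_bound _ hc fun f => ?_
  have h2 : (0 : ℝ) < (2 : ENNReal).toReal := by norm_num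
  refine lp.norm_le_of_forall_sum_le h2 (by positivity) fun s => ?_
  have hf := lp.sum_rpow_le_norm_rpow h2 f
  simp only [ENNReal.toReal_ofNat, Real.rpow_ofNat] at hf ⊢
  have key : ∀ v, ‖(Ad f : ∀ _ : V, ℂ) v‖ ^ 2 ≤
      ∑ w ∈ nb v, c * φ v * (‖(f : ∀ _ : V, ℂ) w‖ ^ 2 / φ w) := by
    intro v
    rw [hAd, ← Finset.mul_sum]
    have hsum : 0 ≤ ∑ w ∈ nb v, ‖(f : ∀ _ : V, ℂ) w‖ ^ 2 / φ w :=
      Finset.sum_nonneg fun w _ => div_nonneg (by positivity) (hφ w).le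
    calc ‖∑ w ∈ nb v, (f : ∀ _ : V, ℂ) w‖ ^ 2
        ≤ (∑ w ∈ nb v, ‖(f : ∀ _ : V, ℂ) w‖) ^ 2 := by
          gcongr; exact norm_sum_le _ _
      _ ≤ (∑ w ∈ nb v, φ w) * ∑ w ∈ nb v, ‖(f : ∀ _ : V, ℂ) w‖ ^ 2 / φ w := by
          apply Finset.sum_sq_le_sum_mul_sum_of_sq_eq_mul
          · intro i _; exact (hφ i).le
          · intro i _; exact div_nonneg (by positivity) (hφ i).le
          · intro i _
            have := (hφ i).ne'
            field_simp
      _ ≤ _ := mul_le_mul_of_nonneg_right (hb v) hsum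
  calc ∑ v ∈ s, ‖(Ad f : ∀ _ : V, ℂ) v‖ ^ 2
      ≤ ∑ v ∈ s, ∑ w ∈ nb v, c * φ v * (‖(f : ∀ _ : V, ℂ) w‖ ^ 2 / φ w) :=
        Finset.sum_le_sum fun v _ => key v
    _ = ∑ w ∈ s.biUnion nb, ∑ v ∈ s.filter (fun v => w ∈ nb v),
          c * φ v * (‖(f : ∀ _ : V, ℂ) w‖ ^ 2 / φ w) := by
        apply Finset.sum_comm'
        intro v w
        simp only [Finset.mem_biUnion, Finset.mem_filter]
        constructor
        · rintro ⟨h1, h2⟩; exact ⟨⟨h1, h2⟩, v, h1, h2⟩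
        · rintro ⟨⟨h1, h2⟩, _⟩; exact ⟨h1, h2⟩
    _ ≤ ∑ w ∈ s.biUnion nb, c ^ 2 * ‖(f : ∀ _ : V, ℂ) w‖ ^ 2 := by
        refine Finset.sum_le_sum fun w _ => ?_
        have hq : 0 ≤ ‖(f : ∀ _ : V, ℂ) w‖ ^ 2 / φ w := div_nonneg (by positivity) (hφ w).le
        calc _ ≤ ∑ v ∈ nb w, c * φ v * (‖(f : ∀ _ : V, ℂ) w‖ ^ 2 / φ w) := by
              apply Finset.sum_le_sum_of_subset_of_nonneg
              · intro v hv
                exact (hsymm _ _).1 (Finset.mem_filter.1 hv).2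
              · intro v _ _
                exact mul_nonneg (mul_nonneg hc (hφ v).le) hq
          _ = c * (∑ v ∈ nb w, φ v) * (‖(f : ∀ _ : V, ℂ) w‖ ^ 2 / φ w) := by
              rw [← Finset.sum_mul, ← Finset.mul_sum]
          _ ≤ c * (c * φ w) * (‖(f : ∀ _ : V, ℂ) w‖ ^ 2 / φ w) := by
              have := hb w
              gcongr
          _ = _ := by
              have := (hφ w).ne'
              field_simp
    _ = c ^ 2 * ∑ w ∈ s.biUnion nb, ‖(f : ∀ _ : V, ℂ) w‖ ^ 2 := by rw [Finset.mul_sum]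
    _ ≤ (c * ‖f‖) ^ 2 := by
        rw [mul_pow]
        have := hf (s.biUnion nb)
        gcongr

/-- The adjacency operator is self-adjoint. -/
theorem adj_selfAdjoint {V : Type*} (nb : V → Finset V)
    (hsymm : ∀ v w, w ∈ nb v ↔ v ∈ nb w)
    (Ad : lp (fun _ : V => ℂ) 2 →L[ℂ] lp (fun _ : V => ℂ) 2)
    (hAd : ∀ (f : lp (fun _ : V => ℂ) 2) (v : V),
      (Ad f : ∀ _ : V, ℂ) v = ∑ w ∈ nb v, (f : ∀ _ : V, ℂ) w) : IsSelfAdjoint Ad := by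
  classical
  rw [ContinuousLinearMap.isSelfAdjoint_iff']
  ext f v
  have hsingle : Ad (lp.single 2 v (1 : ℂ)) = ∑ w ∈ nb v, lp.single 2 w (1 : ℂ) := by
    ext w
    rw [hAd, lp.coeFn_sum, Finset.sum_apply]
    simp only [lp.single_apply, Pi.single_apply, Finset.sum_ite_eq, Finset.sum_ite_eq']
    simp [hsymm v w]
  have h1 : (ContinuousLinearMap.adjoint Ad f : ∀ _ : V, ℂ) v
      = inner ℂ (lp.single 2 v (1 : ℂ) : lp (fun _ : V => ℂ) 2) (ContinuousLinearMap.adjoint Ad f) := by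
    rw [lp.inner_single_left]; simp
  rw [h1, ContinuousLinearMap.adjoint_inner_right, hsingle, sum_inner, hAd]
  refine Finset.sum_congr rfl fun w _ => ?_
  rw [lp.inner_single_left]; simp

/-- Spheres around the root are finite and have doubling cardinality. -/
theorem exists_spheres {V : Type*} (d : V → ℕ) (nb : V → Finset V) (o : V)
    (hsymm : ∀ v w, w ∈ nb v ↔ v ∈ nb w)
    (ho : ∀ v, d v = 0 ↔ v = o)
    (h3 : ∀ v, (nb v).card = 3)
    (hstep : ∀ v, ∀ w ∈ nb v, d v = d w + 1 ∨ d w = d v + 1)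
    (hone : ∀ v, d v ≠ 0 → ((nb v).filter (fun w => d w + 1 = d v)).card = 1) :
    ∃ S : ℕ → Finset V, (∀ n v, v ∈ S n ↔ d v = n) ∧ (S 1).card = 3 ∧
      ∀ n, (S (n + 2)).card = 2 * (S (n + 1)).card := by
  classical
  have hpar : ∀ v, d v ≠ 0 → ∃ w ∈ nb v, d w + 1 = d v := by
    intro v hv
    have : 0 < ((nb v).filter (fun w => d w + 1 = d v)).card := by rw [hone v hv]; norm_num
    obtain ⟨w, hw⟩ := Finset.card_pos.1 this
    exact ⟨w, (Finset.mem_filter.1 hw).1, (Finset.mem_filter.1 hw).2⟩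
  have hfin : ∀ n, {v | d v = n}.Finite := by
    intro n
    induction n with
    | zero =>
      apply (Set.finite_singleton o).subset
      intro v hv
      exact (ho v).1 hv
    | succ n ih =>
      apply (ih.toFinset.biUnion nb).finite_toSet.subset
      intro v hv
      obtain ⟨w, hw, hdw⟩ := hpar v (by simp only [Set.mem_setOf_eq] at hv; omega)
      simp only [Set.mem_setOf_eq] at hv
      simp only [Finset.coe_biUnion, Set.mem_iUnion, Finset.mem_coe, Set.Finite.mem_toFinset,
        Set.mem_setOf_eq]
      exact ⟨w, by omega, (hsymm _ _).1 hw⟩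
  have hS : ∀ n v, v ∈ (hfin n).toFinset ↔ d v = n := by intro n v; simp
  refine ⟨fun n => (hfin n).toFinset, hS, ?_, ?_⟩
  · rw [← h3 o]
    congr 1
    ext v
    rw [hS]
    have ho0 : d o = 0 := (ho o).2 rfl
    constructor
    · intro hv
      obtain ⟨w, hw, hdw⟩ := hpar v (by omega)
      have : w = o := (ho w).1 (by omega)
      subst this
      exact (hsymm _ _).1 hw
    · intro hv
      have := hstep o v hv
      omega
  · intro n
    have := Finset.card_mul_eq_card_mul (s := (hfin (n + 1)).toFinset)
      (t := (hfin (n + 2)).toFinset) (fun v w => w ∈ nb v) (m := 2) (n := 1) ?_ ?_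
    · simp only; omega
    · intro v hv
      rw [hS] at hv
      refine Eq.trans ?_ (up_card d nb h3 hstep hone v (by omega))
      congr 1
      ext w
      simp only [Finset.mem_bipartiteAbove, Finset.mem_filter, hS]
      rw [hv]
      exact and_comm
    · intro v hv
      rw [hS] at hv
      refine Eq.trans ?_ (hone v (by omega))
      congr 1
      ext w
      simp only [Finset.mem_bipartiteBelow, Finset.mem_filter, hS, hsymm v w]
      rw [hv]
      constructor
      · rintro ⟨h1, h2⟩; exact ⟨h2, by omega⟩
      · rintro ⟨h1, h2⟩; exact ⟨by omega, h1⟩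

/-- Let G be the 3-regular tree on the vertex type V (connected, acyclic, every vertex with
exactly 3 neighbors).  If Ad is a bounded operator on ℓ²(V; ℂ) acting as the adjacency
operator, (Ad f)(v) = Σ_{w adjacent to v} f(w), then its spectrum equals the real interval
[−2√2, 2√2] viewed inside ℂ. -/
theorem spectrum_adjacency_three_regular_tree
    {V : Type*} (G : SimpleGraph V)
    (hconn : G.Connected) (hacyclic : G.IsAcyclic)
    (hdeg : ∀ v : V, Nat.card (G.neighborSet v) = 3)
    (Ad : lp (fun _ : V => ℂ) 2 →L[ℂ] lp (fun _ : V => ℂ) 2)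
    (hAd : ∀ (f : lp (fun _ : V => ℂ) 2) (v : V),
      (Ad f : ∀ _ : V, ℂ) v = ∑ᶠ w ∈ G.neighborSet v, (f : ∀ _ : V, ℂ) w) :
    spectrum ℂ Ad = {z : ℂ | ∃ x : ℝ, (x : ℂ) = z ∧ |x| ≤ 2 * Real.sqrt 2} := by
  classical
  obtain ⟨d, nb, o, hnb, ho, h3, hstep, hone⟩ := tree_struct G hconn hacyclic hdeg
  have hsymm : ∀ v w, w ∈ nb v ↔ v ∈ nb w := fun v w => by
    rw [hnb, hnb, SimpleGraph.adj_comm]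
  have hA : ∀ (f : lp (fun _ : V => ℂ) 2) (v : V),
      (Ad f : ∀ _ : V, ℂ) v = ∑ w ∈ nb v, (f : ∀ _ : V, ℂ) w := fun f v => by
    rw [hAd, ← finsum_mem_coe_finset]
    have : G.neighborSet v = (nb v : Set V) := by
      ext w; simp [hnb]
    rw [this]
  have hs : (0 : ℝ) < √2 := by positivity
  have hss : (√2 : ℝ) ^ 2 = 2 := Real.sq_sqrt (by norm_num)
  apply Set.eq_of_subset_of_subset
  · intro z hz
    have hre := (adj_selfAdjoint nb hsymm Ad hA).mem_spectrum_eq_re hz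
    refine ⟨z.re, hre.symm, ?_⟩
    have hnorm := schur_bound nb (fun v => (√2 : ℝ)⁻¹ ^ d v) (2 * √2) (by positivity) hsymm
      (fun v => by positivity) (weight_bound d nb h3 hstep hone) Ad hA
    have : Nontrivial (lp (fun _ : V => ℂ) 2) := by
      refine ⟨lp.single 2 o (1 : ℂ), 0, fun h => ?_⟩
      have := congrArg (fun f : lp (fun _ : V => ℂ) 2 => (f : ∀ _ : V, ℂ) o) h
      simp at this
    exact (Complex.abs_re_le_norm z).trans ((spectrum.norm_le_norm_of_mem hz).trans hnorm)
  · rintro z ⟨x, rfl, hx⟩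
    obtain ⟨S, hS, hS1, hS2⟩ := exists_spheres d nb o hsymm ho h3 hstep hone
    set r : ℝ := (√2)⁻¹ with hr
    have hr2 : r ^ 2 = 1 / 2 := by rw [hr, inv_pow, hss]; norm_num
    have hr1 : √2 * r = 1 := by rw [hr]; field_simp
    have hr1' : ((√2 : ℝ) : ℂ) * (r : ℂ) = 1 := by exact_mod_cast hr1
    have hr3' : (r : ℂ) * 2 = ((√2 : ℝ) : ℂ) := by
      have : r * 2 = √2 := by rw [hr]; field_simp; linarith
      exact_mod_cast this
    let u : ℕ → lp (fun _ : V => ℂ) 2 := fun n => ∑ w ∈ S n, lp.single 2 w ((r : ℂ) ^ n)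
    have hu : ∀ n v, (u n : ∀ _ : V, ℂ) v = if d v = n then (r : ℂ) ^ n else 0 := by
      intro n v
      simp only [u]
      rw [lp.coeFn_sum, Finset.sum_apply]
      simp only [lp.single_apply, Pi.single_apply, Finset.sum_ite_eq]
      simp [hS]
    have hnorm : ∀ n, ‖u n‖ ^ 2 = (S n).card * (r ^ 2) ^ n := by
      intro n
      have := lp.norm_sum_single (p := 2) (E := fun _ : V => ℂ) (by norm_num)
        (fun _ => (r : ℂ) ^ n) (S n)
      simp only [ENNReal.toReal_ofNat, Real.rpow_ofNat] at this
      simp only [u]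
      rw [this, Finset.sum_const, nsmul_eq_mul, norm_pow, Complex.norm_real,
        Real.norm_of_nonneg (by positivity), ← pow_mul, ← pow_mul, mul_comm n 2]
    refine weyl_aux Ad (fun k => u (k + 1)) (3 / 2) (by norm_num) ?_ ?_ ?_ x hx
    · intro k
      rw [hnorm]
      induction k with
      | zero => rw [hS1, hr2]; norm_num
      | succ k ih =>
        rw [hS2, pow_succ, ← ih, hr2]
        push_cast; ring
    · intro i j hij
      rw [lp.inner_eq_tsum]
      convert tsum_zero with v
      rw [hu, hu]
      by_cases h : d v = i + 1
      · rw [if_neg (by omega : ¬ d v = j + 1), inner_zero_right]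
      · rw [if_neg h, inner_zero_left]
    · intro k
      ext v
      rw [hA, lp.coeFn_smul, Pi.smul_apply, lp.coeFn_add, Pi.add_apply, hu, hu]
      simp only [hu, smul_eq_mul]
      rw [← Finset.sum_filter, Finset.sum_const, nsmul_eq_mul]
      by_cases h1 : d v = k + 2 + 1
      · have e : (nb v).filter (fun w => d w = k + 1 + 1) = (nb v).filter (fun w => d w + 1 = d v) := by
          apply Finset.filter_congr; intro w _; omega
        rw [e, hone v (by omega), if_pos h1, if_neg (by omega)]
        push_cast
        linear_combination (-(r : ℂ) ^ (k + 2)) * hr1'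
      · by_cases h2 : d v = k + 1
        · have e : (nb v).filter (fun w => d w = k + 1 + 1)
              = (nb v).filter (fun w => d w = d v + 1) := by
            apply Finset.filter_congr; intro w _; omega
          rw [e, up_card d nb h3 hstep hone v (by omega), if_neg h1, if_pos h2]
          push_cast
          linear_combination ((r : ℂ) ^ (k + 1)) * hr3'
        · have e : (nb v).filter (fun w => d w = k + 1 + 1) = ∅ := by
            apply Finset.filter_false_of_mem
            intro w hw
            have := hstep v w hw
            omega
          rw [e, if_neg h1, if_neg h2]
          simp
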